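/- Let (Ω, P) be a probability space equipped with an action of the isometry group of the hyperbolic plane ℍ by measure-preserving transformations, and let K : Ω → (subsets of ℍ) be such that the set {(ω, z) : z ∈ K(ω)} is measurable with respect to the product of the σ-algebra of Ω and the Borel σ-algebra of ℍ, K(ω) is closed and geodesically convex for every ω ∈ Ω, and K is equivariant: K(γ · ω) = γ(K(ω)) for every isometry γ of ℍ and every ω ∈ Ω. Then P-almost surely, K(ω) = ∅ or K(ω) = ℍ. -/

import Mathlib

open MeasureTheory

section

open Filter Topology Set

/-- An analytic set can be approximated from inside by compact sets, for a finite measure. -/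
theorem exists_isCompact_image_le_measure {X : Type*} [TopologicalSpace X]
    [TopologicalSpace.PseudoMetrizableSpace X]
    [MeasurableSpace X] [BorelSpace X] (μ : Measure X) [IsFiniteMeasure μ]
    {f : (ℕ → ℕ) → X} (hf : Continuous f) {t : ENNReal} (ht : t < μ (range f)) :
    ∃ C : Set (ℕ → ℕ), IsCompact C ∧ t ≤ μ (f '' C) := by
  have step : ∀ (S : Set (ℕ → ℕ)) (k : ℕ), ∃ n : ℕ,
      t < μ (f '' S) → t < μ (f '' (S ∩ {σ | σ k ≤ n})) := by
    intro S k
    have hU : f '' S = ⋃ n : ℕ, f '' (S ∩ {σ | σ k ≤ n}) := by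
      rw [← image_iUnion, ← inter_iUnion]
      congr 1
      ext σ
      simpa using fun _ => ⟨σ k, le_rfl⟩
    have hmono : Monotone fun n : ℕ => f '' (S ∩ {σ | σ k ≤ n}) := by
      intro m n hmn
      refine image_mono (inter_subset_inter_right _ fun σ hσ => ?_)
      exact le_trans hσ hmn
    have hsup : μ (f '' S) = ⨆ n : ℕ, μ (f '' (S ∩ {σ | σ k ≤ n})) := by
      rw [hU, hmono.measure_iUnion]
    by_cases h : t < μ (f '' S)
    · rw [hsup, lt_iSup_iff] at h
      obtain ⟨n, hn⟩ := h
      exact ⟨n, fun _ => hn⟩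
    · exact ⟨0, fun h' => absurd h' h⟩
  choose N hN using step
  let S : ℕ → Set (ℕ → ℕ) := fun k =>
    Nat.rec univ (fun k S => S ∩ {σ | σ k ≤ N S k}) k
  have hS : ∀ k, t < μ (f '' S k) := by
    intro k
    induction k with
    | zero => simpa [S] using ht
    | succ k ih => exact hN _ _ ih
  let b : ℕ → ℕ := fun k => N (S k) k
  have hSb : ∀ k, ∀ σ ∈ S k, ∀ i < k, σ i ≤ b i := by
    intro k
    induction k with
    | zero => intro σ _ i hi; omega
    | succ k ih =>
      intro σ hσ i hi
      rcases Nat.lt_succ_iff_lt_or_eq.1 hi with h | rfl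
      · exact ih σ hσ.1 i h
      · exact hσ.2
  have hC : IsCompact {σ : ℕ → ℕ | ∀ i, σ i ∈ Iic (b i)} :=
    isCompact_pi_infinite fun i => (finite_Iic (b i)).isCompact
  refine ⟨_, hC, ?_⟩
  rw [Set.measure_eq_iInf_isOpen]
  refine le_iInf₂ fun U hCU => le_iInf fun hU => ?_
  suffices ∃ k, S k ⊆ f ⁻¹' U by
    obtain ⟨k, hk⟩ := this
    exact (hS k).le.trans (measure_mono (image_subset_iff.2 hk))
  by_contra! hcon
  simp only [not_subset] at hcon
  choose σ hσS hσU using hcon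
  obtain ⟨τ, hτ, φ, hφ, hlim⟩ := hC.tendsto_subseq (x := fun k i => min (σ k i) (b i))
    fun k i => mem_Iic.2 (min_le_right _ _)
  have hlim' : Tendsto (fun j => σ (φ j)) atTop (𝓝 τ) := by
    rw [tendsto_pi_nhds] at hlim ⊢
    intro i
    refine (hlim i).congr' ?_
    filter_upwards [eventually_gt_atTop i] with j hj
    exact min_eq_left (hSb _ _ (hσS _) i (hj.trans_le (hφ.id_le j)))
  have hmem : τ ∈ (f ⁻¹' U)ᶜ :=
    (hU.preimage hf).isClosed_compl.mem_of_tendsto hlim' (Eventually.of_forall fun j => hσU _)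
  exact hmem (hCU (mem_image_of_mem f hτ))

theorem MeasureTheory.AnalyticSet.nullMeasurableSet {X : Type*} [TopologicalSpace X]
    [TopologicalSpace.MetrizableSpace X]
    [MeasurableSpace X] [BorelSpace X] {s : Set X} (hs : AnalyticSet s)
    (μ : Measure X) [IsFiniteMeasure μ] : NullMeasurableSet s μ := by
  rw [AnalyticSet] at hs
  rcases hs with rfl | ⟨f, hf, rfl⟩
  · exact nullMeasurableSet_empty
  rcases eq_or_ne (μ (range f)) 0 with h0 | h0
  · exact NullMeasurableSet.of_null h0
  obtain ⟨u, -, hu, hlim⟩ := exists_seq_strictMono_tendsto' (pos_iff_ne_zero.2 h0)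
  choose C hC hCμ using fun n => exists_isCompact_image_le_measure μ hf (hu n).2
  have hmeas : MeasurableSet (⋃ n, f '' C n) :=
    MeasurableSet.iUnion fun n => ((hC n).image hf).measurableSet
  refine hmeas.nullMeasurableSet.congr (ae_eq_of_subset_of_measure_ge
    (iUnion_subset fun n => image_subset_range _ _) ?_ hmeas.nullMeasurableSet
    (measure_ne_top _ _))
  exact le_of_tendsto' hlim fun n => (hCμ n).trans (measure_mono (subset_iUnion (fun n => f '' C n) n))

/-- A measurable subset of a product is the pullback of a measurable set under a map to the
product of the Cantor space with the second factor. -/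
theorem MeasurableSet.exists_eq_preimage_cantor_prod {Ω Y : Type*} [MeasurableSpace Ω]
    [MeasurableSpace Y] {E : Set (Ω × Y)} (hE : MeasurableSet E) :
    ∃ g : Ω → ℕ → Bool, Measurable g ∧ ∃ F : Set ((ℕ → Bool) × Y), MeasurableSet F ∧
      E = Prod.map g id ⁻¹' F := by
  classical
  rw [← generateFrom_prod] at hE
  induction E, hE using MeasurableSpace.generateFrom_induction with
  | hC E hE _ =>
    obtain ⟨A, hA, B, hB, rfl⟩ := hE
    refine ⟨fun ω _ => decide (ω ∈ A), measurable_pi_lambda _ fun _ => ?_,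
      {x | x 0 = true} ×ˢ B, ?_, ?_⟩
    · exact measurable_to_bool (by simpa [preimage] using hA)
    · exact (measurableSet_eq_fun (measurable_pi_apply 0) measurable_const).prod hB
    · ext ⟨ω, y⟩
      simp
  | empty => exact ⟨fun _ _ => true, measurable_const, ∅, MeasurableSet.empty, by simp⟩
  | compl E _ ih =>
    obtain ⟨g, hg, F, hF, rfl⟩ := ih
    exact ⟨g, hg, Fᶜ, hF.compl, by simp⟩
  | iUnion E _ ih =>
    choose g hg F hF hE using ih
    refine ⟨fun ω n => g n.unpair.1 ω n.unpair.2, ?_,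
      ⋃ n, Prod.map (fun x k => x (Nat.pair n k)) id ⁻¹' F n, ?_, ?_⟩
    · exact measurable_pi_lambda _ fun n => (measurable_pi_apply _).comp (hg _)
    · refine MeasurableSet.iUnion fun n => ?_
      refine Measurable.prodMap ?_ measurable_id (hF n)
      exact measurable_pi_lambda _ fun k => measurable_pi_apply _
    · rw [preimage_iUnion]
      refine iUnion_congr fun n => ?_
      conv_lhs => rw [hE n]
      ext ⟨ω, y⟩
      simp

/-- Measurable projection theorem. -/
theorem MeasurableSet.nullMeasurableSet_image_fst {Ω Y : Type*} [MeasurableSpace Ω]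
    [TopologicalSpace Y] [PolishSpace Y] [MeasurableSpace Y] [BorelSpace Y]
    {E : Set (Ω × Y)} (hE : MeasurableSet E) (P : Measure Ω) [IsFiniteMeasure P] :
    NullMeasurableSet (Prod.fst '' E) P := by
  have : PolishSpace Bool := inferInstance
  have : PolishSpace (ℕ → Bool) := inferInstance
  obtain ⟨g, hg, F, hF, rfl⟩ := hE.exists_eq_preimage_cantor_prod
  have h : Prod.fst '' (Prod.map g id ⁻¹' F) = g ⁻¹' (Prod.fst '' F) := by
    ext ω
    simp
  rw [h]
  exact ((hF.analyticSet.image_of_continuous continuous_fst).nullMeasurableSet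
    (P.map g)).preimage (hg.measurePreserving P).quasiMeasurePreserving

namespace UpperHalfPlane

/-- The hyperbolic distance between two points of a common semicircle centred on the real axis. -/
theorem dist_eq_abs_arsinh_sub_arsinh {z w : UpperHalfPlane} {c : ℝ}
    (h : (z.re - c) ^ 2 + z.im ^ 2 = (w.re - c) ^ 2 + w.im ^ 2) :
    dist z w = |Real.arsinh ((z.re - c) / z.im) - Real.arsinh ((w.re - c) / w.im)| := by
  have hz := z.im_pos
  have hw := w.im_pos
  have hr : 0 < (z.re - c) ^ 2 + z.im ^ 2 := by positivity
  have hcosh : ∀ u : UpperHalfPlane, Real.cosh (Real.arsinh ((u.re - c) / u.im)) =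
      √((u.re - c) ^ 2 + u.im ^ 2) / u.im := by
    intro u
    have hu := u.im_pos
    rw [Real.cosh_arsinh, eq_div_iff hu.ne', ← Real.sqrt_sq hu.le, ← Real.sqrt_mul (by positivity),
      Real.sqrt_sq hu.le]
    congr 1
    field_simp
    ring
  apply Real.cosh_strictMonoOn.injOn (mem_Ici.2 dist_nonneg) (mem_Ici.2 (abs_nonneg _))
  rw [Real.cosh_abs, Real.cosh_sub, hcosh, hcosh, Real.sinh_arsinh, Real.sinh_arsinh, ← h,
    cosh_dist', div_mul_div_comm, Real.mul_self_sqrt hr.le]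
  field_simp
  linarith

theorem div_im_le_div_im {z w : UpperHalfPlane} {c : ℝ}
    (h : (z.re - c) ^ 2 + z.im ^ 2 = (w.re - c) ^ 2 + w.im ^ 2) (hre : z.re ≤ w.re) :
    (z.re - c) / z.im ≤ (w.re - c) / w.im := by
  have hz := z.im_pos
  have hw := w.im_pos
  rw [div_le_div_iff₀ hz hw]
  rcases le_total 0 (z.re - c) with h0 | h0
  · have : w.im ≤ z.im := abs_le_of_sq_le_sq' (by nlinarith) hz.le |>.2
    nlinarith
  · rcases le_total 0 (w.re - c) with h1 | h1
    · nlinarith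
    · have : z.im ≤ w.im := abs_le_of_sq_le_sq' (by nlinarith) hw.le |>.2
      nlinarith

/-- Three points in order along a semicircle centred on the real axis lie on a geodesic. -/
theorem dist_add_dist_of_semicircle {x y z : UpperHalfPlane} {c : ℝ}
    (hx : (x.re - c) ^ 2 + x.im ^ 2 = (z.re - c) ^ 2 + z.im ^ 2)
    (hy : (z.re - c) ^ 2 + z.im ^ 2 = (y.re - c) ^ 2 + y.im ^ 2)
    (hxz : x.re ≤ z.re) (hzy : z.re ≤ y.re) : dist x z + dist z y = dist x y := by
  have h1 := Real.arsinh_le_arsinh.2 (div_im_le_div_im hx hxz)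
  have h2 := Real.arsinh_le_arsinh.2 (div_im_le_div_im hy hzy)
  rw [dist_eq_abs_arsinh_sub_arsinh hx, dist_eq_abs_arsinh_sub_arsinh hy,
    dist_eq_abs_arsinh_sub_arsinh (hx.trans hy), abs_of_nonpos (by linarith),
    abs_of_nonpos (by linarith), abs_of_nonpos (by linarith)]
  ring

theorem dist_add_dist_of_re_eq {x y z : UpperHalfPlane} (hx : x.re = z.re) (hy : z.re = y.re)
    (hxz : z.im ≤ x.im) (hzy : y.im ≤ z.im) : dist x z + dist z y = dist x y := by
  have h1 := Real.log_le_log z.im_pos hxz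
  have h2 := Real.log_le_log y.im_pos hzy
  rw [dist_of_re_eq hx, dist_of_re_eq hy, dist_of_re_eq (hx.trans hy)]
  simp only [Real.dist_eq]
  rw [abs_of_nonneg (by linarith), abs_of_nonneg (by linarith), abs_of_nonneg (by linarith)]
  ring

/-- The geodesic from a point `x` outside the unit circle to a point `y` inside it crosses the unit
circle at a point whose real part is controlled by the norms of `x` and `y`. -/
theorem exists_dist_add_dist_eq_of_norm {x y : UpperHalfPlane} (hx : 1 < ‖(x : ℂ)‖)
    (hy : ‖(y : ℂ)‖ < 1) :
    ∃ z : UpperHalfPlane, dist x z + dist z y = dist x y ∧ z.re ^ 2 + z.im ^ 2 = 1 ∧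
      |z.re| ≤ (1 + ‖(x : ℂ)‖ * ‖(y : ℂ)‖) / (‖(x : ℂ)‖ + ‖(y : ℂ)‖) := by
  have hX : ‖(x : ℂ)‖ ^ 2 = x.re ^ 2 + x.im ^ 2 := by
    rw [Complex.sq_norm, Complex.normSq_apply, coe_re, coe_im]; ring
  have hY : ‖(y : ℂ)‖ ^ 2 = y.re ^ 2 + y.im ^ 2 := by
    rw [Complex.sq_norm, Complex.normSq_apply, coe_re, coe_im]; ring
  have ha : |x.re| ≤ ‖(x : ℂ)‖ := Complex.abs_re_le_norm x
  have hb : |y.re| ≤ ‖(y : ℂ)‖ := Complex.abs_re_le_norm y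
  have he : 0 ≤ ‖(y : ℂ)‖ := norm_nonneg _
  have hxim := x.im_pos
  have hyim := y.im_pos
  generalize ‖(x : ℂ)‖ = r at *
  generalize ‖(y : ℂ)‖ = e at *
  have hXY : 0 < r ^ 2 - e ^ 2 := by nlinarith
  have hX1 : 0 < r ^ 2 - 1 := by nlinarith
  have hY1 : 0 < 1 - e ^ 2 := by nlinarith
  set p : ℝ := ((1 - e ^ 2) * x.re + (r ^ 2 - 1) * y.re) / (r ^ 2 - e ^ 2) with hp
  have hp' : p * (r ^ 2 - e ^ 2) = (1 - e ^ 2) * x.re + (r ^ 2 - 1) * y.re :=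
    div_mul_cancel₀ _ hXY.ne'
  have hpabs : |p| ≤ (1 + r * e) / (r + e) := by
    rw [hp, abs_div, abs_of_pos hXY, div_le_div_iff₀ hXY (by linarith)]
    have h1 : |(1 - e ^ 2) * x.re + (r ^ 2 - 1) * y.re| ≤ (1 - e ^ 2) * r + (r ^ 2 - 1) * e := by
      refine (abs_add_le _ _).trans ?_
      rw [abs_mul, abs_mul, abs_of_pos hY1, abs_of_pos hX1]
      gcongr
    calc _ ≤ ((1 - e ^ 2) * r + (r ^ 2 - 1) * e) * (r + e) := by gcongr
      _ = _ := by ring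
  have hp1 : |p| < 1 := hpabs.trans_lt <| by
    rw [div_lt_one (by linarith)]
    nlinarith
  have hp2 : 0 < 1 - p ^ 2 := by
    have := (sq_lt_one_iff_abs_lt_one p).2 hp1
    linarith
  have hq : √(1 - p ^ 2) ^ 2 = 1 - p ^ 2 := Real.sq_sqrt hp2.le
  let z : UpperHalfPlane := ⟨⟨p, √(1 - p ^ 2)⟩, Real.sqrt_pos.2 hp2⟩
  have hzre : z.re = p := rfl
  have hzim : z.im ^ 2 = 1 - p ^ 2 := hq
  have hzpos := z.im_pos
  refine ⟨z, ?_, by rw [hzim, hzre]; ring, hpabs⟩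
  rcases eq_or_ne x.re y.re with hab | hab
  · have hpa : p = x.re := by
      have : (p - x.re) * (r ^ 2 - e ^ 2) = 0 := by rw [sub_mul, hp', ← hab]; ring
      rcases mul_eq_zero.1 this with h | h <;> linarith
    refine dist_add_dist_of_re_eq (hpa.symm.trans hzre.symm) (hpa.trans hab) ?_ ?_
    · refine (abs_le_of_sq_le_sq' ?_ hxim.le).2
      rw [hzim, hpa]
      linarith
    · refine (abs_le_of_sq_le_sq' ?_ hzpos.le).2
      rw [hzim, hpa, hab]
      linarith
  · have hab' : x.re - y.re ≠ 0 := sub_ne_zero.2 hab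
    obtain ⟨c, hc⟩ : ∃ c : ℝ, 2 * c * (x.re - y.re) = r ^ 2 - e ^ 2 :=
      ⟨(r ^ 2 - e ^ 2) / (2 * (x.re - y.re)), by field_simp⟩
    have hxp : (x.re - p) * (r ^ 2 - e ^ 2) = (r ^ 2 - 1) * (x.re - y.re) := by
      rw [sub_mul, hp']; ring
    have hyp : (p - y.re) * (r ^ 2 - e ^ 2) = (1 - e ^ 2) * (x.re - y.re) := by
      rw [sub_mul, hp']; ring
    have h1 : 2 * c * (x.re - p) = r ^ 2 - 1 := by
      apply mul_right_cancel₀ hab'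
      linear_combination (x.re - p) * hc + hxp
    have h2 : 2 * c * (p - y.re) = 1 - e ^ 2 := by linear_combination hc - h1
    have hcx : (x.re - c) ^ 2 + x.im ^ 2 = (z.re - c) ^ 2 + z.im ^ 2 := by
      rw [hzim, hzre]
      linear_combination -h1 - hX
    have hcy : (z.re - c) ^ 2 + z.im ^ 2 = (y.re - c) ^ 2 + y.im ^ 2 := by
      rw [hzim, hzre]
      linear_combination -h2 + hY
    rcases lt_or_gt_of_ne hab with h | h
    · have h3 : x.re - p ≤ 0 := nonpos_of_mul_nonpos_left
        (hxp.trans_le (mul_nonpos_of_nonneg_of_nonpos hX1.le (by linarith))) hXY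
      have h4 : p - y.re ≤ 0 := nonpos_of_mul_nonpos_left
        (hyp.trans_le (mul_nonpos_of_nonneg_of_nonpos hY1.le (by linarith))) hXY
      exact dist_add_dist_of_semicircle hcx hcy (by linarith) (by linarith)
    · rw [dist_comm x z, dist_comm z y, dist_comm x y, add_comm]
      have h3 : 0 ≤ x.re - p := nonneg_of_mul_nonneg_left
        ((mul_nonneg hX1.le (by linarith)).trans_eq hxp.symm) hXY
      have h4 : 0 ≤ p - y.re := nonneg_of_mul_nonneg_left
        ((mul_nonneg hY1.le (by linarith)).trans_eq hyp.symm) hXY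
      exact dist_add_dist_of_semicircle hcy.symm hcx.symm (by linarith) (by linarith)

/-- A closed geodesically convex set containing points of arbitrarily large norm and points of
arbitrarily small norm contains `I`. -/
theorem I_mem_of_forall_exists_norm {K : Set UpperHalfPlane} (hclosed : IsClosed K)
    (hconv : ∀ x ∈ K, ∀ y ∈ K, ∀ z : UpperHalfPlane, dist x z + dist z y = dist x y → z ∈ K)
    (hlarge : ∀ R : ℝ, ∃ x ∈ K, R < ‖(x : ℂ)‖) (hsmall : ∀ ε > 0, ∃ y ∈ K, ‖(y : ℂ)‖ < ε) :
    I ∈ K := by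
  rw [← hclosed.closure_eq, isOpenEmbedding_coe.isInducing.closure_eq_preimage_closure_image,
    mem_preimage, Metric.mem_closure_iff]
  intro ε hε
  obtain ⟨x, hxK, hx⟩ := hlarge (max 1 (4 / ε))
  obtain ⟨y, hyK, hy⟩ := hsmall (min 1 (ε / 4)) (by positivity)
  rw [max_lt_iff] at hx
  rw [lt_min_iff] at hy
  obtain ⟨z, hz, hz1, hzre⟩ := exists_dist_add_dist_eq_of_norm hx.1 hy.1
  refine ⟨z, mem_image_of_mem _ (hconv x hxK y hyK z hz), ?_⟩
  have hre : |z.re| < ε / 2 := by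
    refine hzre.trans_lt ?_
    have hx4 := (div_lt_iff₀ hε).1 hx.2
    have hx0 := hx.1
    have he : 0 ≤ ‖(y : ℂ)‖ := norm_nonneg _
    rw [div_lt_iff₀ (by linarith)]
    nlinarith
  have him : |1 - z.im| ≤ |z.re| := by
    have := z.im_pos
    refine sq_le_sq.1 ?_
    nlinarith
  calc dist (I : ℂ) z = ‖(I : ℂ) - z‖ := dist_eq_norm _ _
    _ ≤ |((I : ℂ) - z).re| + |((I : ℂ) - z).im| := Complex.norm_le_abs_re_add_abs_im _
    _ = |z.re| + |1 - z.im| := by simp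
    _ < ε := by linarith

theorem exists_isometryEquiv_apply_I (z : UpperHalfPlane) :
    ∃ γ : UpperHalfPlane ≃ᵢ UpperHalfPlane, γ I = z := by
  obtain ⟨g, hg⟩ := MulAction.exists_smul_eq (Matrix.SpecialLinearGroup (Fin 2) ℝ) I z
  exact ⟨IsometryEquiv.constSMul g, hg⟩

/-- The dilation by a positive real number as an isometry of the upper half-plane. -/
noncomputable def dilation (a : {x : ℝ // 0 < x}) : UpperHalfPlane ≃ᵢ UpperHalfPlane where
  toEquiv := MulAction.toPerm a
  isometry_toFun := isometry_pos_mul a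

theorem coe_dilation_pow (a : {x : ℝ // 0 < x}) (n : ℕ) (z : UpperHalfPlane) :
    (((dilation a ^ n) z : UpperHalfPlane) : ℂ) = (a : ℝ) ^ n * z := by
  induction n with
  | zero => simp
  | succ n ih =>
    rw [pow_succ', IsometryEquiv.mul_apply]
    change ((a • ((dilation a ^ n) z) : UpperHalfPlane) : ℂ) = _
    rw [coe_pos_real_smul, ih]
    simp [pow_succ', mul_assoc]

theorem norm_le_exp_dist (z : UpperHalfPlane) : ‖(z : ℂ)‖ ≤ Real.exp (dist z I) := by
  have h := dist_coe_le z I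
  have h2 : ‖(z : ℂ)‖ ≤ dist (z : ℂ) I + ‖(I : ℂ)‖ := by
    rw [dist_eq_norm]
    simpa using norm_add_le ((z : ℂ) - I) I
  simp at h h2
  linarith

theorem exp_neg_dist_le_norm (z : UpperHalfPlane) : Real.exp (-dist z I) ≤ ‖(z : ℂ)‖ := by
  have h := im_div_exp_dist_le I z
  rw [I_im, one_div, ← Real.exp_neg, dist_comm] at h
  exact h.trans ((le_abs_self _).trans (Complex.abs_im_le_norm z))

end UpperHalfPlane

section RandomConvexSet

variable {Ω : Type*} [MeasurableSpace Ω] (P : Measure Ω) [IsProbabilityMeasure P]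
  {K : Ω → Set UpperHalfPlane}

open UpperHalfPlane in
/-- Almost every realisation of an equivariant random set which comes near `I` comes near `I`
again after infinitely many iterates of a given isometry. -/
theorem ae_frequently_exists_dist_lt [MulAction (UpperHalfPlane ≃ᵢ UpperHalfPlane) Ω]
    {γ : UpperHalfPlane ≃ᵢ UpperHalfPlane}
    (hact : MeasurePreserving (fun ω : Ω => γ • ω) P P)
    (hmeas : MeasurableSet {p : Ω × UpperHalfPlane | p.2 ∈ K p.1})
    (hequiv : ∀ (γ : UpperHalfPlane ≃ᵢ UpperHalfPlane) (ω : Ω), K (γ • ω) = γ '' K ω) :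
    ∀ᵐ ω ∂P, ∀ x ∈ K ω, ∃ r : ℝ, ∃ᶠ n : ℕ in atTop, ∃ y ∈ K ω, dist ((γ ^ n) y) I < r := by
  have hnull : ∀ m : ℕ, NullMeasurableSet {ω | ∃ y ∈ K ω, dist y I < m} P := by
    intro m
    convert (hmeas.inter (measurable_snd (Metric.isOpen_ball (x := I)
      (ε := (m : ℝ))).measurableSet)).nullMeasurableSet_image_fst P using 1
    ext ω
    simp
  have hrec := ae_all_iff.2 fun m => hact.conservative.ae_mem_imp_frequently_image_mem (hnull m)
  filter_upwards [hrec] with ω hω x hx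
  obtain ⟨m, hm⟩ := exists_nat_gt (dist x I)
  refine ⟨m, (hω m ⟨x, hx, hm⟩).mono fun n hn => ?_⟩
  rw [smul_iterate] at hn
  obtain ⟨y, hy, hym⟩ := hn
  rw [hequiv] at hy
  obtain ⟨k, hk, rfl⟩ := hy
  exact ⟨k, hk, hym⟩

open UpperHalfPlane in
theorem ae_nonempty_imp_I_mem [MulAction (UpperHalfPlane ≃ᵢ UpperHalfPlane) Ω]
    (hact : ∀ γ : UpperHalfPlane ≃ᵢ UpperHalfPlane,
      MeasurePreserving (fun ω : Ω => γ • ω) P P)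
    (hmeas : MeasurableSet {p : Ω × UpperHalfPlane | p.2 ∈ K p.1})
    (hclosed : ∀ ω : Ω, IsClosed (K ω))
    (hconv : ∀ ω : Ω, ∀ x ∈ K ω, ∀ y ∈ K ω, ∀ z : UpperHalfPlane,
      dist x z + dist z y = dist x y → z ∈ K ω)
    (hequiv : ∀ (γ : UpperHalfPlane ≃ᵢ UpperHalfPlane) (ω : Ω), K (γ • ω) = γ '' K ω) :
    ∀ᵐ ω ∂P, (K ω).Nonempty → I ∈ K ω := by
  let a : {x : ℝ // 0 < x} := ⟨2, two_pos⟩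
  let b : {x : ℝ // 0 < x} := ⟨2⁻¹, by positivity⟩
  filter_upwards [ae_frequently_exists_dist_lt P (hact (dilation a)) hmeas hequiv,
    ae_frequently_exists_dist_lt P (hact (dilation b)) hmeas hequiv] with ω ha hb ⟨x, hx⟩
  obtain ⟨r, hr⟩ := ha x hx
  obtain ⟨s, hs⟩ := hb x hx
  refine I_mem_of_forall_exists_norm (hclosed ω) (hconv ω) (fun R => ?_) fun ε hε => ?_
  · have hlim : Tendsto (fun n : ℕ => (2 : ℝ) ^ n * Real.exp (-s)) atTop atTop :=
      (tendsto_pow_atTop_atTop_of_one_lt one_lt_two).atTop_mul_const (Real.exp_pos _)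
    obtain ⟨n, ⟨y, hy, hys⟩, hn⟩ := (hs.and_eventually (hlim.eventually_gt_atTop R)).exists
    refine ⟨y, hy, hn.trans_le ?_⟩
    have h := (Real.exp_le_exp.2 (neg_le_neg hys.le)).trans (exp_neg_dist_le_norm _)
    rw [coe_dilation_pow, norm_mul, norm_pow, Complex.norm_real, Real.norm_of_nonneg b.2.le] at h
    calc (2 : ℝ) ^ n * Real.exp (-s) ≤ 2 ^ n * ((2⁻¹ : ℝ) ^ n * ‖(y : ℂ)‖) := by gcongr
      _ = ‖(y : ℂ)‖ := by rw [← mul_assoc, ← mul_pow]; norm_num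
  · have hlim : Tendsto (fun n : ℕ => (2⁻¹ : ℝ) ^ n * Real.exp r) atTop (𝓝 0) := by
      simpa using (tendsto_pow_atTop_nhds_zero_of_lt_one (r := (2⁻¹ : ℝ)) (by norm_num)
        (by norm_num)).mul_const (Real.exp r)
    obtain ⟨n, ⟨y, hy, hyr⟩, hn⟩ := (hr.and_eventually (hlim.eventually_lt_const hε)).exists
    refine ⟨y, hy, lt_of_le_of_lt ?_ hn⟩
    have h := (norm_le_exp_dist _).trans (Real.exp_le_exp.2 hyr.le)
    rw [coe_dilation_pow, norm_mul, norm_pow, Complex.norm_real, Real.norm_of_nonneg a.2.le] at h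
    calc ‖(y : ℂ)‖ = (2⁻¹ : ℝ) ^ n * (2 ^ n * ‖(y : ℂ)‖) := by
          rw [← mul_assoc, ← mul_pow]; norm_num
      _ ≤ (2⁻¹ : ℝ) ^ n * Real.exp r := by gcongr

end RandomConvexSet

end

/-- Let `(Ω, P)` be a probability space with a
measure-preserving action of the isometry group of the hyperbolic plane
(realized as the upper half-plane with its hyperbolic metric), and let
`K : Ω → Set ℍ` be jointly measurable, closed and geodesically convex valued,
and equivariant.  Then almost surely `K ω = ∅` or `K ω = ℍ`. -/
theorem invariant_closed_convex_set_trivial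
    {Ω : Type*} [MeasurableSpace Ω] (P : Measure Ω) [IsProbabilityMeasure P]
    [MulAction (UpperHalfPlane ≃ᵢ UpperHalfPlane) Ω]
    (hact : ∀ γ : UpperHalfPlane ≃ᵢ UpperHalfPlane,
      MeasurePreserving (fun ω : Ω => γ • ω) P P)
    (K : Ω → Set UpperHalfPlane)
    (hmeas : MeasurableSet[MeasurableSpace.prod ‹MeasurableSpace Ω› (borel UpperHalfPlane)]
      {p : Ω × UpperHalfPlane | p.2 ∈ K p.1})
    (hclosed : ∀ ω : Ω, IsClosed (K ω))
    (hconv : ∀ ω : Ω, ∀ x ∈ K ω, ∀ y ∈ K ω, ∀ z : UpperHalfPlane,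
      dist x z + dist z y = dist x y → z ∈ K ω)
    (hequiv : ∀ (γ : UpperHalfPlane ≃ᵢ UpperHalfPlane) (ω : Ω),
      K (γ • ω) = γ '' K ω) :
    ∀ᵐ ω ∂P, K ω = ∅ ∨ K ω = Set.univ := by
  rw [← BorelSpace.measurable_eq (α := UpperHalfPlane)] at hmeas
  have hI := ae_nonempty_imp_I_mem P hact hmeas hclosed hconv hequiv
  have hz : ∀ z : UpperHalfPlane, ∀ᵐ ω ∂P, (K ω).Nonempty → z ∈ K ω := by
    intro z
    obtain ⟨γ, hγ⟩ := UpperHalfPlane.exists_isometryEquiv_apply_I z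
    filter_upwards [(hact γ⁻¹).quasiMeasurePreserving.ae hI] with ω hω hne
    have h := hω (by rw [hequiv]; exact hne.image _)
    have h' : γ UpperHalfPlane.I ∈ K (γ • γ⁻¹ • ω) := by
      rw [hequiv γ]
      exact Set.mem_image_of_mem _ h
    rwa [smul_inv_smul, hγ] at h'
  filter_upwards [ae_all_iff.2 fun n => hz (TopologicalSpace.denseSeq UpperHalfPlane n)] with ω hω
  refine (K ω).eq_empty_or_nonempty.imp_right fun hne => ?_
  refine Set.eq_univ_of_univ_subset ?_
  rw [← (TopologicalSpace.denseRange_denseSeq UpperHalfPlane).closure_range]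
  exact (hclosed ω).closure_subset_iff.2 (Set.range_subset_iff.2 fun n => hω n hne)
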